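/- arXiv:1210.3896 — 2 statements merged into one kernel-verified Lean document; each statement's English description precedes it below -/
import Mathlib

section
/- Let δ, λ₀ ∈ ℝ with λ₀ ≠ 0, λ₀ + δ ≠ 1, and 2λ₀ + δ ≠ 1, and let A^{ab} = A^{ba}, A^a, A be smooth real functions on ℝⁿ. Then there exist unique smooth functions S^{ab} = S^{ba}, γ^a, θ on ℝⁿ such that the canonical pencil Δ_λ f = (1/2)(S^{ab}∂_a∂_b f + (∂_b S^{ba})∂_a f + (2λ+δ−1)γ^a∂_a f + λ(∂_aγ^a)f + λ(λ+δ−1)θ f) satisfies Δ_{λ₀} f = A^{ab}∂_a∂_b f + A^a∂_a f + A·f for all smooth f. Explicitly, S^{ab} = 2A^{ab}, γ^a = (2A^a − ∂_b S^{ba})/(2λ₀+δ−1), and θ = (2A − λ₀∂_aγ^a)/(λ₀(λ₀+δ−1)). -/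
open MeasureTheory Real

/-- Partial derivative of a function on ℝⁿ in the direction of the `a`-th coordinate. -/
noncomputable def pd {n : ℕ} (a : Fin n) (f : (Fin n → ℝ) → ℝ) : (Fin n → ℝ) → ℝ :=
  fun x => fderiv ℝ f x (Pi.single a 1)

/-- The canonical pencil operator of weight `δ` with data `(S, γ, θ)`. -/
noncomputable def pencil {n : ℕ} (δ lam : ℝ) (S : Fin n → Fin n → (Fin n → ℝ) → ℝ)
    (γ : Fin n → (Fin n → ℝ) → ℝ) (θ : (Fin n → ℝ) → ℝ)
    (f : (Fin n → ℝ) → ℝ) (x : Fin n → ℝ) : ℝ :=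
  (1/2) * (∑ a, ∑ b, S a b x * pd a (pd b f) x
    + ∑ a, (∑ b, pd b (S b a) x) * pd a f x
    + (2*lam + δ - 1) * ∑ a, γ a x * pd a f x
    + lam * (∑ a, pd a (γ a) x) * f x
    + lam * (lam + δ - 1) * θ x * f x)

theorem ContDiff.pd {n : ℕ} {f : (Fin n → ℝ) → ℝ} (hf : ContDiff ℝ (⊤ : ℕ∞) f) (a : Fin n) :
    ContDiff ℝ (⊤ : ℕ∞) (pd a f) :=
  (hf.fderiv_right (m := (⊤ : ℕ∞)) (by simp)).clm_apply contDiff_const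

theorem pd_const {n : ℕ} (a : Fin n) (c : ℝ) : pd a (fun _ => c) = fun _ => 0 := by
  funext x
  simp [pd]

theorem pd_coord_sub {n : ℕ} (a i : Fin n) (c : ℝ) :
    pd a (fun y => y i - c) = fun _ => if i = a then 1 else 0 := by
  funext x
  have h : HasFDerivAt (fun y : Fin n → ℝ => y i - c)
      (ContinuousLinearMap.proj (R := ℝ) (φ := fun _ : Fin n => ℝ) i) x :=
    (hasFDerivAt_apply i x).sub_const c
  simp [pd, h.fderiv, Pi.single_apply]

theorem pd_mul {n : ℕ} (a : Fin n) {f g : (Fin n → ℝ) → ℝ}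
    (hf : Differentiable ℝ f) (hg : Differentiable ℝ g) :
    pd a (fun y => f y * g y) = fun y => f y * pd a g y + pd a f y * g y := by
  funext x
  simp [pd, fderiv_fun_mul (hf x) (hg x), mul_comm]

theorem pd_const_mul_add_mul_const {n : ℕ} (a : Fin n) (c d : ℝ) {f g : (Fin n → ℝ) → ℝ}
    (hf : Differentiable ℝ f) (hg : Differentiable ℝ g) :
    pd a (fun y => f y * c + d * g y) = fun y => pd a f y * c + d * pd a g y := by
  funext x
  have h := ((hf x).hasFDerivAt.mul_const c).fun_add ((hg x).hasFDerivAt.const_mul d)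
  simp [pd, h.fderiv, mul_comm c]

/-- The second derivatives of the product of two coordinate functions. -/
theorem pd_pd_coord_mul {n : ℕ} (a b i j : Fin n) (c d : ℝ) :
    pd a (pd b (fun y => (y i - c) * (y j - d))) = fun _ =>
      (if i = a then 1 else 0) * (if j = b then 1 else 0)
        + (if i = b then 1 else 0) * (if j = a then 1 else 0) := by
  have hi : Differentiable ℝ (fun y : Fin n → ℝ => y i - c) := by fun_prop
  have hj : Differentiable ℝ (fun y : Fin n → ℝ => y j - d) := by fun_prop
  rw [pd_mul b hi hj, pd_coord_sub, pd_coord_sub, pd_const_mul_add_mul_const a _ _ hi hj,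
    pd_coord_sub, pd_coord_sub]

/-- A second order operator that kills all smooth functions at a point has vanishing
coefficients there. -/
theorem coeff_eq_zero_of_operator_eq_zero {n : ℕ} (c2 : Fin n → Fin n → ℝ) (c1 : Fin n → ℝ)
    (c0 : ℝ) (x : Fin n → ℝ) (hsymm : ∀ a b, c2 a b = c2 b a)
    (h : ∀ f : (Fin n → ℝ) → ℝ, ContDiff ℝ (⊤ : ℕ∞) f →
      ∑ a, ∑ b, c2 a b * pd a (pd b f) x + ∑ a, c1 a * pd a f x + c0 * f x = 0) :
    (∀ a b, c2 a b = 0) ∧ (∀ a, c1 a = 0) ∧ c0 = 0 := by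
  refine ⟨fun i j => ?_, fun i => ?_, ?_⟩
  · have hf := h (fun y => (y i - x i) * (y j - x j)) (by fun_prop)
    simp only [pd_pd_coord_mul] at hf
    simp only [pd_mul _ (f := fun y : Fin n → ℝ => y i - x i)
      (g := fun y : Fin n → ℝ => y j - x j) (by fun_prop) (by fun_prop)] at hf
    simp [mul_add, Finset.sum_add_distrib] at hf
    linarith [hsymm i j]
  · have hf := h (fun y => y i - x i) (by fun_prop)
    simpa [pd_coord_sub, pd_const] using hf
  · have hf := h (fun _ => 1) contDiff_const
    simpa [pd_const] using hf

theorem pencil_eq {n : ℕ} (δ lam : ℝ) (S : Fin n → Fin n → (Fin n → ℝ) → ℝ)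
    (γ : Fin n → (Fin n → ℝ) → ℝ) (θ f : (Fin n → ℝ) → ℝ) (x : Fin n → ℝ) :
    pencil δ lam S γ θ f x = ∑ a, ∑ b, (S a b x / 2) * pd a (pd b f) x
      + ∑ a, ((∑ b, pd b (S b a) x + (2*lam + δ - 1) * γ a x) / 2) * pd a f x
      + ((lam * ∑ a, pd a (γ a) x + lam * (lam + δ - 1) * θ x) / 2) * f x := by
  have e2 : ∑ a, ∑ b, (S a b x / 2) * pd a (pd b f) x
      = (∑ a, ∑ b, S a b x * pd a (pd b f) x) / 2 := by
    simp only [Finset.sum_div, div_mul_eq_mul_div]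
  have e1 : ∑ a, ((∑ b, pd b (S b a) x + (2*lam + δ - 1) * γ a x) / 2) * pd a f x
      = (∑ a, (∑ b, pd b (S b a) x) * pd a f x
        + (2*lam + δ - 1) * ∑ a, γ a x * pd a f x) / 2 := by
    rw [Finset.mul_sum, ← Finset.sum_add_distrib, Finset.sum_div]
    exact Finset.sum_congr rfl fun a _ => by ring
  rw [e2, e1, pencil]
  ring

/-- universality of the canonical pencil: away from the singular weights
there is exactly one canonical pencil of weight `δ` passing through a given second order
operator acting on densities of weight `λ₀`, with explicitly given data `(S, γ, θ)`. -/
theorem statement5 (n : ℕ) (δ lam0 : ℝ)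
    (h0 : lam0 ≠ 0) (h1 : lam0 + δ ≠ 1) (h2 : 2*lam0 + δ ≠ 1)
    (A2 : Fin n → Fin n → (Fin n → ℝ) → ℝ) (A1 : Fin n → (Fin n → ℝ) → ℝ)
    (A0 : (Fin n → ℝ) → ℝ)
    (hA2 : ∀ a b, ContDiff ℝ (⊤ : ℕ∞) (A2 a b)) (hA2symm : ∀ a b, A2 a b = A2 b a)
    (hA1 : ∀ a, ContDiff ℝ (⊤ : ℕ∞) (A1 a)) (hA0 : ContDiff ℝ (⊤ : ℕ∞) A0)
    -- the explicit data:
    (Sx : Fin n → Fin n → (Fin n → ℝ) → ℝ) (γx : Fin n → (Fin n → ℝ) → ℝ)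
    (θx : (Fin n → ℝ) → ℝ)
    (hSx : ∀ a b x, Sx a b x = 2 * A2 a b x)
    (hγx : ∀ a x, γx a x = (2 * A1 a x - ∑ b, pd b (Sx b a) x) / (2*lam0 + δ - 1))
    (hθx : ∀ x, θx x = (2 * A0 x - lam0 * ∑ a, pd a (γx a) x) / (lam0 * (lam0 + δ - 1))) :
    -- existence: the explicit data is smooth, symmetric and its pencil passes
    -- through the operator A at λ = λ₀
    ((∀ a b, ContDiff ℝ (⊤ : ℕ∞) (Sx a b)) ∧ (∀ a b, Sx a b = Sx b a) ∧
     (∀ a, ContDiff ℝ (⊤ : ℕ∞) (γx a)) ∧ ContDiff ℝ (⊤ : ℕ∞) θx ∧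
     (∀ f : (Fin n → ℝ) → ℝ, ContDiff ℝ (⊤ : ℕ∞) f → ∀ x,
       pencil δ lam0 Sx γx θx f x
         = ∑ a, ∑ b, A2 a b x * pd a (pd b f) x + ∑ a, A1 a x * pd a f x + A0 x * f x))
    ∧
    -- uniqueness: any smooth symmetric data whose pencil passes through A coincides
    -- with the explicit data
    (∀ (S : Fin n → Fin n → (Fin n → ℝ) → ℝ) (γ : Fin n → (Fin n → ℝ) → ℝ)
       (θ : (Fin n → ℝ) → ℝ),
      (∀ a b, ContDiff ℝ (⊤ : ℕ∞) (S a b)) → (∀ a b, S a b = S b a) →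
      (∀ a, ContDiff ℝ (⊤ : ℕ∞) (γ a)) → ContDiff ℝ (⊤ : ℕ∞) θ →
      (∀ f : (Fin n → ℝ) → ℝ, ContDiff ℝ (⊤ : ℕ∞) f → ∀ x,
        pencil δ lam0 S γ θ f x
          = ∑ a, ∑ b, A2 a b x * pd a (pd b f) x + ∑ a, A1 a x * pd a f x + A0 x * f x) →
      S = Sx ∧ γ = γx ∧ θ = θx) := by
  have hw1 : 2 * lam0 + δ - 1 ≠ 0 := sub_ne_zero.mpr h2
  have hw0 : lam0 + δ - 1 ≠ 0 := sub_ne_zero.mpr h1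
  have hS : ∀ a b, ContDiff ℝ (⊤ : ℕ∞) (Sx a b) := fun a b => by
    rw [funext (hSx a b)]
    exact contDiff_const.mul (hA2 a b)
  have hγ : ∀ a, ContDiff ℝ (⊤ : ℕ∞) (γx a) := fun a => by
    rw [funext (hγx a)]
    exact ((contDiff_const.mul (hA1 a)).sub
      (ContDiff.sum fun b _ => (hS b a).pd b)).div_const _
  have hθ : ContDiff ℝ (⊤ : ℕ∞) θx := by
    rw [funext hθx]
    exact ((contDiff_const.mul hA0).sub
      (contDiff_const.mul (ContDiff.sum fun a _ => (hγ a).pd a))).div_const _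
  refine ⟨⟨hS, fun a b => ?_, hγ, hθ, fun f _ x => ?_⟩, ?_⟩
  · funext x
    rw [hSx, hSx, hA2symm]
  · have k2 : ∀ a b, Sx a b x / 2 = A2 a b x := fun a b => by rw [hSx]; ring
    have k1 : ∀ a, (∑ b, pd b (Sx b a) x + (2*lam0 + δ - 1) * γx a x) / 2 = A1 a x :=
      fun a => by rw [hγx]; field_simp; ring
    have k0 : (lam0 * ∑ a, pd a (γx a) x + lam0 * (lam0 + δ - 1) * θx x) / 2 = A0 x := by
      rw [hθx]; field_simp; ring
    simp only [pencil_eq, k2, k1, k0]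
  · intro S γ θ _ hSsymm _ _ h
    have key := fun x => coeff_eq_zero_of_operator_eq_zero
      (fun a b => S a b x / 2 - A2 a b x)
      (fun a => (∑ b, pd b (S b a) x + (2*lam0 + δ - 1) * γ a x) / 2 - A1 a x)
      ((lam0 * ∑ a, pd a (γ a) x + lam0 * (lam0 + δ - 1) * θ x) / 2 - A0 x) x
      (fun a b => by rw [hSsymm a b, hA2symm a b])
      (fun f hf => by
        have e := h f hf x
        rw [pencil_eq] at e
        simp only [sub_mul, Finset.sum_sub_distrib] at e ⊢
        linarith)
    obtain rfl : S = Sx := by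
      funext a b x
      rw [hSx]
      linarith [(key x).1 a b]
    obtain rfl : γ = γx := by
      funext a x
      rw [hγx, eq_div_iff hw1]
      linarith [(key x).2.1 a]
    refine ⟨rfl, rfl, funext fun x => ?_⟩
    rw [hθx, eq_div_iff (mul_ne_zero h0 hw0)]
    linarith [(key x).2.2]
end

section
/- Let δ ∈ ℝ, let S^{ab} = S^{ba} be smooth functions on ℝⁿ, and let γ_a, X_a, Y_a be smooth covector fields on ℝⁿ. Define div_γ X = ∂_a(S^{ab}X_b) + (δ−1)γ_a S^{ab}X_b and ⟨X,Y⟩ = X_a S^{ab} Y_b. Then the identity (div_γ X + ((δ−1)/2)⟨X,X⟩) + (div_{γ+X} Y + ((δ−1)/2)⟨Y,Y⟩) = div_γ(X+Y) + ((δ−1)/2)⟨X+Y, X+Y⟩ holds. In particular, if div_γ X + ((δ−1)/2)⟨X,X⟩ = 0 and div_{γ+X} Y + ((δ−1)/2)⟨Y,Y⟩ = 0, then div_γ(X+Y) + ((δ−1)/2)⟨X+Y, X+Y⟩ = 0. -/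
open MeasureTheory Real

/-- The divergence `div_γ X = ∂_a(S^{ab}X_b) + (δ−1) γ_a S^{ab} X_b` of a covector
field `X` with respect to a connection `γ`, for a symbol `S` of weight `δ`. -/
noncomputable def divg {n : ℕ} (δ : ℝ) (S : Fin n → Fin n → (Fin n → ℝ) → ℝ)
    (γ X : Fin n → (Fin n → ℝ) → ℝ) (x : Fin n → ℝ) : ℝ :=
  ∑ a, pd a (fun y => ∑ b, S a b y * X b y) x + (δ - 1) * ∑ a, ∑ b, γ a x * S a b x * X b x

/-- The scalar product `⟨X,Y⟩ = X_a S^{ab} Y_b`. -/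
noncomputable def scalSq {n : ℕ} (S : Fin n → Fin n → (Fin n → ℝ) → ℝ)
    (X Y : Fin n → (Fin n → ℝ) → ℝ) (x : Fin n → ℝ) : ℝ :=
  ∑ a, ∑ b, X a x * S a b x * Y b x

/-- The partial derivative is additive on differentiable functions. -/
theorem pd_add {n : ℕ} (a : Fin n) {f g : (Fin n → ℝ) → ℝ} {x : Fin n → ℝ}
    (hf : DifferentiableAt ℝ f x) (hg : DifferentiableAt ℝ g x) :
    pd a (fun y => f y + g y) x = pd a f x + pd a g x := by
  simp [pd, fderiv_fun_add hf hg]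

/-- The divergence with respect to a fixed connection is additive in the covector field. -/
theorem divg_add {n : ℕ} (δ : ℝ) {S : Fin n → Fin n → (Fin n → ℝ) → ℝ}
    (γ : Fin n → (Fin n → ℝ) → ℝ) {X Y : Fin n → (Fin n → ℝ) → ℝ} {x : Fin n → ℝ}
    (hS : ∀ a b, DifferentiableAt ℝ (S a b) x) (hX : ∀ a, DifferentiableAt ℝ (X a) x)
    (hY : ∀ a, DifferentiableAt ℝ (Y a) x) :
    divg δ S γ (fun a y => X a y + Y a y) x = divg δ S γ X x + divg δ S γ Y x := by
  have hd : ∀ {Z : Fin n → (Fin n → ℝ) → ℝ}, (∀ b, DifferentiableAt ℝ (Z b) x) →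
      ∀ a, DifferentiableAt ℝ (fun y => ∑ b, S a b y * Z b y) x :=
    fun hZ a => DifferentiableAt.fun_sum fun b _ => (hS a b).mul (hZ b)
  have hpd : ∀ a, pd a (fun y => ∑ b, S a b y * (X b y + Y b y)) x =
      pd a (fun y => ∑ b, S a b y * X b y) x + pd a (fun y => ∑ b, S a b y * Y b y) x := by
    intro a
    rw [← pd_add a (hd hX a) (hd hY a)]
    simp only [mul_add, Finset.sum_add_distrib]
  simp only [divg, hpd]
  simp only [mul_add, Finset.sum_add_distrib]
  ring

/-- Shifting the connection by `X` changes the divergence of `Y` by `(δ - 1)⟨X, Y⟩`. -/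
theorem divg_add_connection {n : ℕ} (δ : ℝ) (S : Fin n → Fin n → (Fin n → ℝ) → ℝ)
    (γ X Y : Fin n → (Fin n → ℝ) → ℝ) (x : Fin n → ℝ) :
    divg δ S (fun a y => γ a y + X a y) Y x = divg δ S γ Y x + (δ - 1) * scalSq S X Y x := by
  simp only [divg, scalSq, add_mul, Finset.sum_add_distrib]
  ring

theorem scalSq_comm {n : ℕ} {S : Fin n → Fin n → (Fin n → ℝ) → ℝ}
    (hS : ∀ a b, S a b = S b a) (X Y : Fin n → (Fin n → ℝ) → ℝ) (x : Fin n → ℝ) :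
    scalSq S X Y x = scalSq S Y X x := by
  unfold scalSq
  rw [Finset.sum_comm]
  refine Finset.sum_congr rfl fun a _ => Finset.sum_congr rfl fun b _ => ?_
  rw [hS b a]
  ring

theorem scalSq_add_self {n : ℕ} {S : Fin n → Fin n → (Fin n → ℝ) → ℝ}
    (hS : ∀ a b, S a b = S b a) (X Y : Fin n → (Fin n → ℝ) → ℝ) (x : Fin n → ℝ) :
    scalSq S (fun a y => X a y + Y a y) (fun a y => X a y + Y a y) x =
      scalSq S X X x + 2 * scalSq S X Y x + scalSq S Y Y x := by
  have hcomm := scalSq_comm hS X Y x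
  simp only [scalSq, add_mul, mul_add, Finset.sum_add_distrib] at hcomm ⊢
  linarith

/-- the cocycle identity expressing closure under composition of the arrows
`γ → γ + X` of the groupoid of connections `C_S`. -/
theorem statement8 (n : ℕ) (δ : ℝ)
    (S : Fin n → Fin n → (Fin n → ℝ) → ℝ) (γ X Y : Fin n → (Fin n → ℝ) → ℝ)
    (hS : ∀ a b, ContDiff ℝ (⊤ : ℕ∞) (S a b)) (hSsymm : ∀ a b, S a b = S b a)
    (hγ : ∀ a, ContDiff ℝ (⊤ : ℕ∞) (γ a)) (hX : ∀ a, ContDiff ℝ (⊤ : ℕ∞) (X a))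
    (hY : ∀ a, ContDiff ℝ (⊤ : ℕ∞) (Y a)) :
    -- the identity:
    (∀ x, (divg δ S γ X x + ((δ - 1)/2) * scalSq S X X x)
        + (divg δ S (fun a y => γ a y + X a y) Y x + ((δ - 1)/2) * scalSq S Y Y x)
      = divg δ S γ (fun a y => X a y + Y a y) x
        + ((δ - 1)/2) * scalSq S (fun a y => X a y + Y a y) (fun a y => X a y + Y a y) x)
    ∧
    -- in particular, composability of groupoid arrows:
    ((∀ x, divg δ S γ X x + ((δ - 1)/2) * scalSq S X X x = 0) →
     (∀ x, divg δ S (fun a y => γ a y + X a y) Y x + ((δ - 1)/2) * scalSq S Y Y x = 0) →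
     (∀ x, divg δ S γ (fun a y => X a y + Y a y) x
        + ((δ - 1)/2) * scalSq S (fun a y => X a y + Y a y) (fun a y => X a y + Y a y) x = 0)) := by
  have key : ∀ x, (divg δ S γ X x + ((δ - 1)/2) * scalSq S X X x)
        + (divg δ S (fun a y => γ a y + X a y) Y x + ((δ - 1)/2) * scalSq S Y Y x)
      = divg δ S γ (fun a y => X a y + Y a y) x
        + ((δ - 1)/2) * scalSq S (fun a y => X a y + Y a y) (fun a y => X a y + Y a y) x := by
    intro x
    rw [divg_add δ γ (fun a b => (hS a b).differentiable (by simp) x)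
      (fun a => (hX a).differentiable (by simp) x) (fun a => (hY a).differentiable (by simp) x),
      divg_add_connection, scalSq_add_self hSsymm]
    ring
  refine ⟨key, fun h₁ h₂ x => ?_⟩
  rw [← key x, h₁ x, h₂ x, add_zero]
end
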